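/- Let n ≥ 3 and let P_n be the path graph on [n]. For the binomial edge ideal J = J_{K_2,P_n} ⊂ K[x_{1,1},…,x_{2,n}] and any cut set T of P_n, the local v-number satisfies v_T(J^k) = v_T(J) + 2(k−1) for every integer k ≥ 1. -/

import Mathlib

open MvPolynomial

noncomputable def minor (K : Type*) [Field K] (i j k l : ℕ) : MvPolynomial (ℕ × ℕ) K :=
  X (i, k) * X (j, l) - X (i, l) * X (j, k)

/-- The path graph `P_n` on the vertices `1, …, n`. -/
def pathGraph (n : ℕ) : SimpleGraph ℕ :=
  SimpleGraph.fromRel (fun u v => 1 ≤ u ∧ v = u + 1 ∧ v ≤ n)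

/-- The binomial edge ideal `J_{K_2,P_n}`, generated by
`x_{1,i}x_{2,i+1} − x_{1,i+1}x_{2,i}` for `i = 1,…,n−1`. -/
noncomputable def pathBEI (K : Type*) [Field K] (n : ℕ) : Ideal (MvPolynomial (ℕ × ℕ) K) :=
  Ideal.span {f | ∃ i : ℕ, 1 ≤ i ∧ i + 1 ≤ n ∧ f = minor K 1 2 i (i + 1)}

/-- The associated prime `P_T(K_2,P_n)` of the binomial edge ideal of the path:
variables `x_{1,j}, x_{2,j}` for `j ∈ T` together with all minors on pairs `u < v`
lying in a common component of `P_n \ T` (i.e. with no element of `T` in between). -/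
noncomputable def pathPT (K : Type*) [Field K] (n : ℕ) (T : Set ℕ) :
    Ideal (MvPolynomial (ℕ × ℕ) K) :=
  Ideal.span ({f | ∃ i j : ℕ, (i = 1 ∨ i = 2) ∧ j ∈ T ∧ f = X (i, j)} ∪
    {f | ∃ u v : ℕ, u < v ∧ u ∈ Set.Icc 1 n \ T ∧ v ∈ Set.Icc 1 n \ T ∧
      (∀ w ∈ T, ¬ (u < w ∧ w < v)) ∧ f = minor K 1 2 u v})

/-- The local v-number of `I` at `P_T(K_2,P_n)`: the least degree of a homogeneous `f`
with `(I : f) = P_T`. -/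
noncomputable def localVNumberPath (K : Type*) [Field K] (n : ℕ) (T : Set ℕ)
    (I : Ideal (MvPolynomial (ℕ × ℕ) K)) : ℕ :=
  sInf {d : ℕ | ∃ f : MvPolynomial (ℕ × ℕ) K, f.IsHomogeneous d ∧
    Submodule.colon I (Ideal.span {f}) = pathPT K n T}


section QuasiRegular
variable {R : Type*} [CommRing R]

/-- The ideal generated by the first `r` elements of a sequence. -/
def seqIdeal (f : ℕ → R) (r : ℕ) : Ideal R := Ideal.span (f '' Set.Iio r)

/-- `F` is a form of degree `s` in the first `r` variables. -/
def IsForm (r s : ℕ) (F : MvPolynomial ℕ R) : Prop :=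
  ∀ m, coeff m F ≠ 0 → m.degree = s ∧ ∀ i, r ≤ i → m i = 0

lemma seqIdeal_mono (f : ℕ → R) {r r' : ℕ} (h : r ≤ r') : seqIdeal f r ≤ seqIdeal f r' :=
  Ideal.span_mono (Set.image_mono (Set.Iio_subset_Iio h))

lemma mem_seqIdeal (f : ℕ → R) {i r : ℕ} (h : i < r) : f i ∈ seqIdeal f r :=
  Ideal.subset_span ⟨i, h, rfl⟩

lemma IsForm.zero (r s : ℕ) : IsForm r s (0 : MvPolynomial ℕ R) := by
  intro m hm; simp at hm

lemma IsForm.add {r s : ℕ} {F G : MvPolynomial ℕ R} (hF : IsForm r s F) (hG : IsForm r s G) :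
    IsForm r s (F + G) := by
  intro m hm
  by_cases h : coeff m F = 0
  · apply hG; intro h'; apply hm; simp [h, h']
  · exact hF m h

lemma IsForm.C_mul {r s : ℕ} {F : MvPolynomial ℕ R} (c : R) (hF : IsForm r s F) :
    IsForm r s (C c * F) := by
  intro m hm
  apply hF; intro h; apply hm; simp [h]

lemma IsForm.sub {r s : ℕ} {F G : MvPolynomial ℕ R} (hF : IsForm r s F) (hG : IsForm r s G) :
    IsForm r s (F - G) := by
  have := hF.add (hG.C_mul (-1))
  simpa [sub_eq_add_neg] using this

lemma IsForm.mono {r r' s : ℕ} {F : MvPolynomial ℕ R} (h : r ≤ r') (hF : IsForm r s F) :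
    IsForm r' s F := fun m hm => ⟨(hF m hm).1, fun i hi => (hF m hm).2 i (h.trans hi)⟩

lemma IsForm.mul_X {r s i : ℕ} {F : MvPolynomial ℕ R} (hi : i < r) (hF : IsForm r s F) :
    IsForm r (s + 1) (F * X i) := by
  intro m hm
  rw [coeff_mul_X'] at hm
  split_ifs at hm with h
  · obtain ⟨h1, h2⟩ := hF _ hm
    have hle : Finsupp.single i 1 ≤ m := by
      rw [Finsupp.single_le_iff]
      have := Finsupp.mem_support_iff.mp h
      omega
    have hm' : m = (m - Finsupp.single i 1) + Finsupp.single i 1 := (tsub_add_cancel_of_le hle).symm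
    constructor
    · rw [hm', map_add, h1, Finsupp.degree_single]
    · intro j hj
      have h3 := h2 j hj
      rw [hm', Finsupp.add_apply, h3, Finsupp.single_apply, if_neg (by omega), add_zero]
  · exact absurd rfl hm

lemma IsForm.one (r : ℕ) : IsForm r 0 (1 : MvPolynomial ℕ R) := by
  intro m hm
  rw [coeff_one] at hm
  split_ifs at hm with h
  · subst h; simp
  · exact absurd rfl hm

lemma IsForm.eq_C {r : ℕ} {F : MvPolynomial ℕ R} (hF : IsForm r 0 F) : F = C (coeff 0 F) := by
  ext m
  rw [coeff_C]
  split_ifs with h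
  · rw [h]
  · by_contra h'
    have := (hF m h').1
    rw [Finsupp.degree_eq_zero_iff] at this
    exact h this.symm

lemma prod_mem_pow_degree (f : ℕ → R) (r : ℕ) (m : ℕ →₀ ℕ) (hm : ∀ i, r ≤ i → m i = 0) :
    (m.prod fun i e => f i ^ e) ∈ seqIdeal f r ^ m.degree := by
  rw [Finsupp.prod, Finsupp.degree_apply, ← Finset.prod_pow_eq_pow_sum]
  apply Ideal.prod_mem_prod
  intro i hi
  apply Ideal.pow_mem_pow
  apply mem_seqIdeal
  by_contra h
  exact (Finsupp.mem_support_iff.mp hi) (hm i (not_lt.mp h))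

lemma IsForm.eval_mem {r s : ℕ} {F : MvPolynomial ℕ R} (f : ℕ → R) (hF : IsForm r s F) :
    eval f F ∈ seqIdeal f r ^ s := by
  rw [eval_eq]
  apply Ideal.sum_mem
  intro m hm
  obtain ⟨h1, h2⟩ := hF m (mem_support_iff.mp hm)
  apply Ideal.mul_mem_left
  have := prod_mem_pow_degree f r m h2
  rwa [h1] at this

lemma IsForm.eval_mem_succ {r s : ℕ} {F : MvPolynomial ℕ R} (f : ℕ → R) (hF : IsForm r s F)
    (hc : ∀ m, coeff m F ∈ seqIdeal f r) :
    eval f F ∈ seqIdeal f r ^ (s + 1) := by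
  rw [eval_eq]
  apply Ideal.sum_mem
  intro m hm
  obtain ⟨h1, h2⟩ := hF m (mem_support_iff.mp hm)
  rw [pow_succ']
  apply Ideal.mul_mem_mul (hc m)
  have := prod_mem_pow_degree f r m h2
  rwa [h1] at this

lemma exists_form_mul (f : ℕ → R) (r s : ℕ) (G : MvPolynomial ℕ R) (hG : IsForm r s G) (x : R)
    (hx : x ∈ seqIdeal f r) :
    ∃ F : MvPolynomial ℕ R, IsForm r (s + 1) F ∧ eval f F = x * eval f G := by
  refine Submodule.span_induction (p := fun x _ => ∃ F : MvPolynomial ℕ R, IsForm r (s + 1) F ∧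
    eval f F = x * eval f G) ?_ ?_ ?_ ?_ hx
  · rintro _ ⟨i, hi, rfl⟩
    exact ⟨G * X i, hG.mul_X hi, by simp [mul_comm]⟩
  · exact ⟨0, IsForm.zero _ _, by simp⟩
  · rintro x y _ _ ⟨F, hF, h1⟩ ⟨F', hF', h2⟩
    exact ⟨F + F', hF.add hF', by simp [h1, h2, add_mul]⟩
  · rintro c x _ ⟨F, hF, h1⟩
    exact ⟨C c * F, hF.C_mul c, by simp [h1, mul_assoc]⟩

lemma exists_form (f : ℕ → R) (r s : ℕ) : ∀ x ∈ seqIdeal f r ^ s,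
    ∃ F : MvPolynomial ℕ R, IsForm r s F ∧ eval f F = x := by
  induction s with
  | zero =>
    intro x _
    exact ⟨C x * 1, (IsForm.one r).C_mul x, by simp⟩
  | succ s ih =>
    intro x hx
    rw [pow_succ'] at hx
    refine Submodule.mul_induction_on hx ?_ ?_
    · intro a ha b hb
      obtain ⟨G, hG, rfl⟩ := ih b hb
      exact exists_form_mul f r s G hG a ha
    · rintro x y ⟨F, hF, rfl⟩ ⟨F', hF', rfl⟩
      exact ⟨F + F', hF.add hF', by simp⟩

lemma exists_form_coeff (f : ℕ → R) (r s : ℕ) (x : R) (hx : x ∈ seqIdeal f r ^ (s + 1)) :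
    ∃ F : MvPolynomial ℕ R, IsForm r s F ∧ (∀ m, coeff m F ∈ seqIdeal f r) ∧ eval f F = x := by
  rw [pow_succ'] at hx
  refine Submodule.mul_induction_on hx ?_ ?_
  · intro a ha b hb
    obtain ⟨G, hG, rfl⟩ := exists_form f r s b hb
    refine ⟨C a * G, hG.C_mul a, fun m => ?_, by simp⟩
    rw [coeff_C_mul]
    exact Ideal.mul_mem_right _ _ ha
  · rintro x y ⟨F, hF, h, rfl⟩ ⟨F', hF', h', rfl⟩
    exact ⟨F + F', hF.add hF', fun m => by rw [coeff_add]; exact Ideal.add_mem _ (h m) (h' m),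
      by simp⟩

/-- quasi-regularity of the first `r` elements -/
def QuasiReg (f : ℕ → R) (r : ℕ) : Prop :=
  ∀ s F, IsForm r s F → eval f F ∈ seqIdeal f r ^ (s + 1) → ∀ m, coeff m F ∈ seqIdeal f r

lemma QuasiReg.nzd_pow {f : ℕ → R} {r : ℕ} (h : QuasiReg f r) (y : R)
    (hy : ∀ g, y * g ∈ seqIdeal f r → g ∈ seqIdeal f r) (k : ℕ) (g : R)
    (hg : y * g ∈ seqIdeal f r ^ k) : g ∈ seqIdeal f r ^ k := by
  have key : ∀ s, s ≤ k → g ∈ seqIdeal f r ^ s := by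
    intro s
    induction s with
    | zero => intro _; simp
    | succ s ih =>
      intro hs
      obtain ⟨F, hF, rfl⟩ := exists_form f r s g (ih (by omega))
      apply hF.eval_mem_succ
      intro m
      apply hy
      rw [← coeff_C_mul]
      apply h s _ (hF.C_mul y)
      simpa using Ideal.pow_le_pow_right hs hg
  exact key k le_rfl

lemma quasiReg_of_regular (f : ℕ → R) (r : ℕ)
    (hreg : ∀ i < r, ∀ g, f i * g ∈ seqIdeal f i → g ∈ seqIdeal f i) : QuasiReg f r := by
  have base : ∀ r F, IsForm r 0 F → eval f F ∈ seqIdeal f r ^ (0 + 1) →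
      ∀ m, coeff m F ∈ seqIdeal f r := by
    intro r F hF he m
    rw [hF.eq_C] at he ⊢
    rw [coeff_C]
    split_ifs
    · simpa using he
    · exact zero_mem _
  induction r with
  | zero =>
    intro s F hF he m
    rcases s with _ | s
    · exact base _ F hF he m
    · by_cases hm : coeff m F = 0
      · rw [hm]; exact zero_mem _
      · obtain ⟨h1, h2⟩ := hF m hm
        have : m = 0 := by ext i; exact h2 i (Nat.zero_le _)
        subst this
        simp at h1
  | succ r ihr =>
    have ihr := ihr (fun i hi => hreg i (by omega))
    intro s
    induction s with
    | zero => exact base _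
    | succ s ihs =>
      -- reduce to the case of a vanishing form
      suffices key : ∀ F, IsForm (r + 1) (s + 1) F → eval f F = 0 →
          ∀ m, coeff m F ∈ seqIdeal f (r + 1) by
        intro F hF he m
        obtain ⟨F2, hF2, hc, hev⟩ := exists_form_coeff f (r + 1) (s + 1) _ he
        have := key (F - F2) (hF.sub hF2) (by simp [hev]) m
        rw [coeff_sub] at this
        have h2 := Ideal.add_mem _ this (hc m)
        simpa using h2
      intro F hF he
      set G := F.divMonomial (Finsupp.single r 1) with hGdef
      set F' := F.modMonomial (Finsupp.single r 1) with hF'def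
      have hdec : X r * G + F' = F := divMonomial_add_modMonomial_single F r
      have hG : IsForm (r + 1) s G := by
        intro m hm
        rw [hGdef, coeff_divMonomial] at hm
        obtain ⟨h1, h2⟩ := hF _ hm
        rw [map_add, Finsupp.degree_single] at h1
        refine ⟨by omega, fun i hi => ?_⟩
        have := h2 i hi
        rw [Finsupp.add_apply] at this
        omega
      have hF' : IsForm r (s + 1) F' := by
        intro m hm
        by_cases hle : Finsupp.single r 1 ≤ m
        · exact absurd (coeff_modMonomial_of_le F hle) hm
        · rw [hF'def, coeff_modMonomial_of_not_le F hle] at hm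
          obtain ⟨h1, h2⟩ := hF _ hm
          refine ⟨h1, fun i hi => ?_⟩
          rw [Finsupp.single_le_iff] at hle
          rcases hi.eq_or_lt with rfl | hi
          · omega
          · exact h2 i hi
      have hev : f r * eval f G + eval f F' = 0 := by
        rw [← he, ← hdec]; simp
      have hGmem : eval f G ∈ seqIdeal f r ^ (s + 1) := by
        apply ihr.nzd_pow (f r) (hreg r (by omega))
        rw [eq_neg_of_add_eq_zero_left hev]
        exact (Ideal.neg_mem_iff _).mpr (hF'.eval_mem f)
      obtain ⟨H, hH, hHe⟩ := exists_form f r (s + 1) _ hGmem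
      have h1 := ihr (s + 1) (C (f r) * H + F') ((hH.C_mul _).add hF') (by
        simp [hHe, hev])
      have hmono := seqIdeal_mono f (Nat.le_succ r)
      have hF'c : ∀ m, coeff m F' ∈ seqIdeal f (r + 1) := by
        intro m
        have h2 := hmono (h1 m)
        rw [coeff_add, coeff_C_mul] at h2
        exact (Ideal.add_mem_iff_right _
          (Ideal.mul_mem_right _ _ (mem_seqIdeal f (Nat.lt_succ_self r)))).mp h2
      have hGc := ihs G hG (Ideal.pow_right_mono hmono _ hGmem)
      intro m
      rw [← hdec, coeff_add, coeff_X_mul']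
      apply Ideal.add_mem _ _ (hF'c m)
      split_ifs
      · exact hGc _
      · exact zero_mem _

end QuasiRegular

section Regular
variable {σ K : Type*} [DecidableEq σ] [Field K]

/-- Setting one variable to zero. -/
noncomputable def killVar (K : Type*) [Field K] (v : σ) : MvPolynomial σ K →ₐ[K] MvPolynomial σ K :=
  aeval (fun j => if j = v then 0 else X j)

lemma killVar_X_self (v : σ) : killVar K v (X v) = 0 := by simp [killVar]

lemma killVar_X_ne {v w : σ} (h : w ≠ v) : killVar K v (X w) = X w := by simp [killVar, h]

lemma killVar_add (v : σ) (p : MvPolynomial σ K) :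
    p = killVar K v p + X v * p.divMonomial (Finsupp.single v 1) := by
  have h := divMonomial_add_modMonomial_single p v
  have h2 : killVar K v p = p.modMonomial (Finsupp.single v 1) := by
    have h3 : X v ∣ p - killVar K v p := by
      induction p using MvPolynomial.induction_on with
      | C a => simp [killVar]
      | add p q hp hq =>
        rw [map_add, add_sub_add_comm]
        exact dvd_add (hp (divMonomial_add_modMonomial_single p v))
          (hq (divMonomial_add_modMonomial_single q v))
      | mul_X p i hp =>
        have hp := hp (divMonomial_add_modMonomial_single p v)
        rw [map_mul]
        by_cases hi : i = v
        · subst hi; simp [killVar_X_self]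
        · rw [killVar_X_ne hi, ← sub_mul]
          exact Dvd.dvd.mul_right hp _
    refine (eq_modMonomial_single_iff h3).mpr ?_
    intro m hm
    by_contra hv
    have h4 : coeff m (killVar K v p) = 0 := by
      clear h h3 hm
      induction p using MvPolynomial.induction_on generalizing m with
      | C a =>
        simp only [killVar, aeval_C, algebraMap_eq, coeff_C]
        rw [if_neg]
        rintro rfl
        simp at hv
      | add p q hp hq => rw [map_add, coeff_add, hp m hv, hq m hv, add_zero]
      | mul_X p i hp =>
        rw [map_mul]
        by_cases hi : i = v
        · subst hi; simp [killVar_X_self]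
        · rw [killVar_X_ne hi, coeff_mul_X']
          split_ifs
          · apply hp
            simpa [Finsupp.single_apply, hi] using hv
          · rfl
    exact (mem_support_iff.mp hm) h4
  rw [h2, add_comm, h]

variable {S : Set (MvPolynomial σ K)} {v : σ}

lemma span_decomp (hS : ∀ f ∈ S, killVar K v f = f) (j : MvPolynomial σ K)
    (hj : j ∈ Ideal.span S) :
    killVar K v j ∈ Ideal.span S ∧ ∃ j' ∈ Ideal.span S, j = killVar K v j + X v * j' := by
  refine Submodule.span_induction (p := fun j _ => killVar K v j ∈ Ideal.span S ∧
    ∃ j' ∈ Ideal.span S, j = killVar K v j + X v * j') ?_ ?_ ?_ ?_ hj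
  · intro x hx
    rw [hS x hx]
    exact ⟨Ideal.subset_span hx, 0, zero_mem _, by simp⟩
  · exact ⟨by simp, 0, zero_mem _, by simp⟩
  · rintro x y _ _ ⟨h1, x', h2, h3⟩ ⟨h4, y', h5, h6⟩
    refine ⟨by rw [map_add]; exact add_mem h1 h4, x' + y', add_mem h2 h5, ?_⟩
    conv_lhs => rw [h3, h6]
    rw [map_add]; ring
  · rintro c x hx ⟨h1, x', h2, h3⟩
    refine ⟨by rw [smul_eq_mul, map_mul]; exact Ideal.mul_mem_left _ _ h1,
      c.divMonomial (Finsupp.single v 1) * x + killVar K v c * x', ?_, ?_⟩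
    · exact add_mem (Ideal.mul_mem_left _ _ hx) (Ideal.mul_mem_left _ _ h2)
    · have hc := killVar_add v c
      rw [smul_eq_mul, map_mul]
      generalize c.divMonomial (Finsupp.single v 1) = c' at *
      generalize killVar K v c = c0 at *
      generalize killVar K v x = x0 at *
      rw [hc]
      linear_combination c0 * h3

lemma newVar_nzd (hS : ∀ f ∈ S, killVar K v f = f) (g : MvPolynomial σ K)
    (hg : X v * g ∈ Ideal.span S) : g ∈ Ideal.span S := by
  obtain ⟨-, j', hj', h⟩ := span_decomp hS _ hg
  rw [map_mul, killVar_X_self, zero_mul, zero_add] at h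
  rwa [mul_left_cancel₀ (X_ne_zero v) h]

/-- `a w - u b` is a nonzerodivisor modulo `J` if `u`, `w` are new variables and `a` is a
nonzerodivisor. -/
lemma binom_nzd {u w : σ} (huw : u ≠ w) (a b : MvPolynomial σ K)
    (hu : ∀ f ∈ S, killVar K u f = f) (hw : ∀ f ∈ S, killVar K w f = f)
    (ha : killVar K u a = a)
    (hreg : ∀ g, a * g ∈ Ideal.span S → g ∈ Ideal.span S) (g : MvPolynomial σ K)
    (hg : (a * X w - X u * b) * g ∈ Ideal.span S) : g ∈ Ideal.span S := by
  have key : ∀ N : ℕ, ∀ g : MvPolynomial σ K, (∀ m, coeff m g ≠ 0 → m u < N) →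
      (a * X w - X u * b) * g ∈ Ideal.span S → g ∈ Ideal.span S := by
    intro N
    induction N with
    | zero =>
      intro g hN _
      have : g = 0 := by
        ext m
        by_contra h
        exact absurd (hN m h) (Nat.not_lt_zero _)
      rw [this]; exact zero_mem _
    | succ N ih =>
      intro g hN hg
      have h1 : killVar K u g ∈ Ideal.span S := by
        have h2 := (span_decomp hu _ hg).1
        rw [map_mul, map_sub, map_mul, map_mul, killVar_X_self, zero_mul, sub_zero, ha,
          killVar_X_ne huw.symm] at h2
        apply newVar_nzd hw
        apply hreg
        rwa [← mul_assoc]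
      have hdec := killVar_add u g
      have h3 : g.divMonomial (Finsupp.single u 1) ∈ Ideal.span S := by
        apply ih
        · intro m hm
          rw [coeff_divMonomial] at hm
          have := hN _ hm
          simp at this
          omega
        · apply newVar_nzd hu
          have h4 := sub_mem hg (Ideal.mul_mem_left _ (a * X w - X u * b) h1)
          convert h4 using 1
          conv_rhs => enter [1]; rw [hdec]
          ring
      rw [hdec]
      exact add_mem h1 (Ideal.mul_mem_left _ _ h3)
  refine key (degreeOf u g + 1) g ?_ hg
  intro m hm
  have := (degreeOf_lt_iff (f := g) (n := u) (d := degreeOf u g + 1) (by omega)).mp (by omega) m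
    (mem_support_iff.mpr hm)
  exact this

lemma newVar_nzd_add {u w : σ} (huw : u ≠ w) (a b : MvPolynomial σ K)
    (hu : ∀ f ∈ S, killVar K u f = f) (hw : ∀ f ∈ S, killVar K w f = f)
    (ha : killVar K u a = a)
    (hreg : ∀ g, a * g ∈ Ideal.span S → g ∈ Ideal.span S) (g : MvPolynomial σ K)
    (hg : X u * g ∈ Ideal.span (insert (a * X w - X u * b) S)) :
    g ∈ Ideal.span (insert (a * X w - X u * b) S) := by
  rw [Ideal.mem_span_insert] at hg ⊢
  obtain ⟨h, j, hj, he⟩ := hg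
  have h0 : killVar K u h ∈ Ideal.span S := by
    apply newVar_nzd hw
    apply hreg
    have h2 := congrArg (killVar K u) he
    simp only [map_mul, map_add, map_sub, killVar_X_self, zero_mul, sub_zero, ha,
      killVar_X_ne huw.symm] at h2
    have h3 : a * (X w * killVar K u h) = - killVar K u j := by linear_combination -h2
    rw [h3]
    exact neg_mem (span_decomp hu _ hj).1
  have hdec := killVar_add u h
  set h' := h.divMonomial (Finsupp.single u 1)
  refine ⟨h', g - h' * (a * X w - X u * b), ?_, by ring⟩
  apply newVar_nzd hu
  have h4 : X u * (g - h' * (a * X w - X u * b)) = j + (a * X w - X u * b) * killVar K u h := by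
    rw [mul_sub, he]
    linear_combination (a * X w - X u * b) * hdec
  rw [h4]
  exact add_mem hj (Ideal.mul_mem_left _ _ h0)

end Regular

section PathSeq
variable (K : Type*) [Field K]

/-- The generators of the binomial edge ideal of a path, indexed from `0`. -/
noncomputable def pathSeq (i : ℕ) : MvPolynomial (ℕ × ℕ) K := minor K 1 2 (i + 1) (i + 2)

lemma killVar_pathSeq (p i l : ℕ) (h : i + 2 < l) :
    killVar K (p, l) (pathSeq K i) = pathSeq K i := by
  simp only [pathSeq, minor, map_sub, map_mul]
  rw [killVar_X_ne, killVar_X_ne, killVar_X_ne, killVar_X_ne] <;> simp <;> omega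

lemma pathSeq_eq (i : ℕ) : pathSeq K i =
    X (1, i + 1) * X (2, i + 2) - X (1, i + 2) * X (2, i + 1) := rfl

lemma pathSeq_var_nzd (i : ℕ) : ∀ g, X (1, i + 1) * g ∈ seqIdeal (pathSeq K) i →
    g ∈ seqIdeal (pathSeq K) i := by
  induction i with
  | zero =>
    intro g hg
    apply newVar_nzd (v := ((1, 1) : ℕ × ℕ)) _ g hg
    rintro _ ⟨i, hi, rfl⟩
    exact absurd hi (by simp)
  | succ i ih =>
    intro g hg
    have hI : pathSeq K '' Set.Iio (i + 1) = insert (pathSeq K i) (pathSeq K '' Set.Iio i) := by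
      rw [← Set.image_insert_eq]
      congr 1
      ext x; simp only [Set.mem_Iio, Set.mem_insert_iff]; omega
    unfold seqIdeal at hg ih ⊢
    rw [hI] at hg ⊢
    refine newVar_nzd_add (u := ((1, i + 2) : ℕ × ℕ)) (w := (2, i + 2)) (by simp) _ _ ?_ ?_ ?_ ih g hg
    · rintro _ ⟨k, hk, rfl⟩
      exact killVar_pathSeq K _ _ _ (by simp at hk; omega)
    · rintro _ ⟨k, hk, rfl⟩
      exact killVar_pathSeq K _ _ _ (by simp at hk; omega)
    · exact killVar_X_ne (by simp)

lemma pathSeq_nzd (i : ℕ) : ∀ g, pathSeq K i * g ∈ seqIdeal (pathSeq K) i →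
    g ∈ seqIdeal (pathSeq K) i := by
  intro g hg
  refine binom_nzd (u := ((1, i + 2) : ℕ × ℕ)) (w := (2, i + 2)) (by simp) (X (1, i + 1))
    (X (2, i + 1)) ?_ ?_ ?_ (pathSeq_var_nzd K i) g hg
  · rintro _ ⟨k, hk, rfl⟩
    exact killVar_pathSeq K _ _ _ (by simp at hk; omega)
  · rintro _ ⟨k, hk, rfl⟩
    exact killVar_pathSeq K _ _ _ (by simp at hk; omega)
  · exact killVar_X_ne (by simp)

lemma pathSeq_quasiReg (r : ℕ) : QuasiReg (pathSeq K) r :=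
  quasiReg_of_regular _ r fun i _ => pathSeq_nzd K i

end PathSeq

section Toric
variable {σ τ K : Type*} [Field K]

open Classical in
/-- A monomial map: variables in `Z` go to zero, the others to monomials with exponents `e`. -/
noncomputable def toricMap (K : Type*) [Field K] (Z : Set σ) (e : σ → (τ →₀ ℕ)) :
    MvPolynomial σ K →ₐ[K] MvPolynomial τ K :=
  aeval (fun v => if v ∈ Z then 0 else monomial (e v) 1)

/-- The map on exponents induced by `e`. -/
noncomputable def toricExp (e : σ → (τ →₀ ℕ)) : (σ →₀ ℕ) →+ (τ →₀ ℕ) :=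
  Finsupp.liftAddHom (fun v => multiplesHom _ (e v))

lemma toricExp_single (e : σ → (τ →₀ ℕ)) (v : σ) (k : ℕ) :
    toricExp e (Finsupp.single v k) = k • e v := by
  simp [toricExp]

lemma toricMap_X_mem {Z : Set σ} (e : σ → (τ →₀ ℕ)) {v : σ} (hv : v ∈ Z) :
    toricMap K Z e (X v) = 0 := by simp [toricMap, hv]

lemma toricMap_X {Z : Set σ} (e : σ → (τ →₀ ℕ)) {v : σ} (hv : v ∉ Z) :
    toricMap K Z e (X v) = monomial (e v) 1 := by simp [toricMap, hv]

lemma toricMap_monomial_mem {Z : Set σ} (e : σ → (τ →₀ ℕ)) (m : σ →₀ ℕ)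
    {v : σ} (hv : v ∈ Z) (hm : m v ≠ 0) :
    toricMap K Z e (monomial m 1) = 0 := by
  rw [toricMap, aeval_monomial, map_one, one_mul, Finsupp.prod]
  apply Finset.prod_eq_zero (Finsupp.mem_support_iff.mpr hm)
  rw [if_pos hv, zero_pow hm]

lemma toricMap_monomial {Z : Set σ} (e : σ → (τ →₀ ℕ)) (m : σ →₀ ℕ)
    (hm : ∀ v ∈ Z, m v = 0) :
    toricMap K Z e (monomial m 1) = monomial (toricExp e m) 1 := by
  induction m using Finsupp.induction with
  | zero => simp
  | single_add v k m hv hk ih =>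
    have hvZ : v ∉ Z := by
      intro h
      have := hm v h
      simp at this
      exact hk this.1
    have hmZ : ∀ v ∈ Z, m v = 0 := by
      intro w hw
      have := hm w hw
      rw [Finsupp.add_apply] at this
      omega
    have h1 : (monomial (Finsupp.single v k + m) (1 : K)) = X v ^ k * monomial m 1 := by
      rw [X_pow_eq_monomial, monomial_mul, one_mul]
    rw [h1, map_mul, map_pow, toricMap_X e hvZ, ih hmZ, map_add, toricExp_single, monomial_pow,
      monomial_mul, one_pow, one_mul]

open Classical in
lemma toricMap_ker_le (Z : Set σ) (e : σ → (τ →₀ ℕ)) (P : Ideal (MvPolynomial σ K))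
    (hZ : ∀ v ∈ Z, X v ∈ P)
    (hE : ∀ m m' : σ →₀ ℕ, (∀ v ∈ Z, m v = 0) → (∀ v ∈ Z, m' v = 0) →
      toricExp e m = toricExp e m' → monomial m (1 : K) - monomial m' 1 ∈ P) :
    ∀ p, toricMap K Z e p = 0 → p ∈ P := by
  let ψ : MvPolynomial τ K →ₗ[K] (MvPolynomial σ K ⧸ P) :=
    (basisMonomials τ K).constr K (fun N =>
      if h : ∃ m : σ →₀ ℕ, (∀ v ∈ Z, m v = 0) ∧ toricExp e m = N then
        Ideal.Quotient.mk P (monomial h.choose 1) else 0)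
  have hψ : ψ ∘ₗ (toricMap K Z e).toLinearMap = (Ideal.Quotient.mkₐ K P).toLinearMap := by
    apply (basisMonomials σ K).ext
    intro m
    simp only [coe_basisMonomials, LinearMap.comp_apply, AlgHom.toLinearMap_apply,
      Ideal.Quotient.mkₐ_eq_mk]
    by_cases hm : ∀ v ∈ Z, m v = 0
    · rw [toricMap_monomial e m hm]
      have h : ∃ m' : σ →₀ ℕ, (∀ v ∈ Z, m' v = 0) ∧ toricExp e m' = toricExp e m := ⟨m, hm, rfl⟩
      have h2 : ψ (monomial (toricExp e m) 1) = Ideal.Quotient.mk P (monomial h.choose 1) := by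
        have h3 := (basisMonomials τ K).constr_basis K (fun N =>
          if h : ∃ m : σ →₀ ℕ, (∀ v ∈ Z, m v = 0) ∧ toricExp e m = N then
            Ideal.Quotient.mk P (monomial h.choose 1) else 0) (toricExp e m)
        rw [dif_pos h, coe_basisMonomials] at h3
        exact h3
      rw [h2, Ideal.Quotient.mk_eq_mk_iff_sub_mem]
      exact hE _ _ h.choose_spec.1 hm h.choose_spec.2
    · push Not at hm
      obtain ⟨v, hv, hmv⟩ := hm
      rw [toricMap_monomial_mem e m hv hmv, map_zero, eq_comm, Ideal.Quotient.eq_zero_iff_mem]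
      obtain ⟨q, hq⟩ : (X v : MvPolynomial σ K) ∣ monomial m 1 := X_dvd_monomial.mpr (Or.inr hmv)
      rw [hq]
      exact Ideal.mul_mem_right _ _ (hZ v hv)
  intro p hp
  have h := LinearMap.congr_fun hψ p
  simp only [LinearMap.comp_apply, AlgHom.toLinearMap_apply, hp, map_zero,
    Ideal.Quotient.mkₐ_eq_mk] at h
  exact Ideal.Quotient.eq_zero_iff_mem.mp h.symm

end Toric

section PT

/-- the component label of a column -/
def comp (T : Set ℕ) (j : ℕ) : Set ℕ := {w ∈ T | w < j}

/-- exponent data of the parametrization of `P_T` -/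
noncomputable def ptExp (n : ℕ) (T : Set ℕ) (v : ℕ × ℕ) : ((ℕ × ℕ) ⊕ Set ℕ) →₀ ℕ :=
  if v.1 = 2 ∧ 1 ≤ v.2 ∧ v.2 ≤ n then
    Finsupp.single (Sum.inl (1, v.2)) 1 + Finsupp.single (Sum.inr (comp T v.2)) 1
  else Finsupp.single (Sum.inl v) 1

/-- the variables in `P_T` -/
def ptVars (T : Set ℕ) : Set (ℕ × ℕ) := {v | (v.1 = 1 ∨ v.1 = 2) ∧ v.2 ∈ T}

variable (n : ℕ) (T : Set ℕ)

lemma ptExp_inl_one (m : ℕ × ℕ →₀ ℕ) (j : ℕ) (h1 : 1 ≤ j) (h2 : j ≤ n) :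
    toricExp (ptExp n T) m (Sum.inl (1, j)) = m (1, j) + m (2, j) := by
  induction m using Finsupp.induction_linear with
  | zero => simp
  | add f g hf hg => rw [map_add, Finsupp.add_apply, hf, hg]; simp; ring
  | single v k =>
    obtain ⟨a, b⟩ := v
    rw [toricExp_single]
    unfold ptExp
    split_ifs with h
    · obtain ⟨h3, -⟩ := h
      simp only at h3
      subst h3
      simp [Finsupp.single_apply]
    · simp only [Finsupp.smul_apply, Finsupp.single_apply, Sum.inl.injEq, Prod.mk.injEq, smul_eq_mul]
      simp only at h
      by_cases hb : b = j
      · subst hb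
        have : a ≠ 2 := fun h' => h ⟨h', h1, h2⟩
        by_cases ha : a = 1 <;> simp [this, ha]
      · simp [hb]

lemma ptExp_inl_other (m : ℕ × ℕ →₀ ℕ) (v : ℕ × ℕ)
    (hv : ¬ ((v.1 = 1 ∨ v.1 = 2) ∧ 1 ≤ v.2 ∧ v.2 ≤ n)) :
    toricExp (ptExp n T) m (Sum.inl v) = m v := by
  induction m using Finsupp.induction_linear with
  | zero => simp
  | add f g hf hg => rw [map_add, Finsupp.add_apply, hf, hg]; simp
  | single w k =>
    rw [toricExp_single]
    unfold ptExp
    split_ifs with h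
    · have h1 : (1, w.2) ≠ v := by
        rintro rfl
        exact hv ⟨Or.inl rfl, h.2⟩
      have h2 : w ≠ v := by
        rintro rfl
        exact hv ⟨Or.inr h.1, h.2⟩
      simp [Finsupp.single_apply, h1, h2]
    · simp [Finsupp.single_apply]

open Classical in
lemma ptExp_inr (m : ℕ × ℕ →₀ ℕ) (c : Set ℕ) :
    toricExp (ptExp n T) m (Sum.inr c) =
      ∑ j ∈ (Finset.Icc 1 n).filter (fun j => comp T j = c), m (2, j) := by
  induction m using Finsupp.induction_linear with
  | zero => simp
  | add f g hf hg => rw [map_add, Finsupp.add_apply, hf, hg]; simp [Finset.sum_add_distrib]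
  | single w k =>
    obtain ⟨a, b⟩ := w
    rw [toricExp_single]
    unfold ptExp
    split_ifs with h
    · obtain ⟨h3, h4, h5⟩ := h
      simp only at h3 h4 h5
      subst h3
      by_cases hc : comp T b = c
      · simp [Finsupp.single_apply, hc, h4, h5, Finset.sum_ite_eq]
      · simp [Finsupp.single_apply, hc, Finset.sum_ite_eq]
    · simp only at h
      rw [Finset.sum_eq_zero]
      · simp [Finsupp.single_apply]
      · intro j hj
        simp only [Finset.mem_filter, Finset.mem_Icc] at hj
        rw [Finsupp.single_apply, if_neg]
        rintro ⟨⟩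
        exact h ⟨rfl, hj.1⟩

variable {n T}

open Classical in
lemma ptExp_row_two {m m' : ℕ × ℕ →₀ ℕ} (h : toricExp (ptExp n T) m = toricExp (ptExp n T) m')
    (j : ℕ) (h1 : 1 ≤ j) (h2 : j ≤ n) (hm : m (2, j) ≠ 0) :
    ∃ l, 1 ≤ l ∧ l ≤ n ∧ comp T l = comp T j ∧ m' (2, l) ≠ 0 := by
  by_contra hcon
  push Not at hcon
  have h3 := congrArg (fun x => x (Sum.inr (comp T j))) h
  simp only [ptExp_inr] at h3
  rw [Finset.sum_eq_zero (f := fun j => m' (2, j))] at h3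
  · rw [Finset.sum_eq_zero_iff] at h3
    exact hm (h3 j (by simp [h1, h2]))
  · intro l hl
    simp only [Finset.mem_filter, Finset.mem_Icc] at hl
    exact hcon l hl.1.1 hl.1.2 hl.2

open Classical in
lemma ptExp_row_one {m m' : ℕ × ℕ →₀ ℕ} (h : toricExp (ptExp n T) m = toricExp (ptExp n T) m')
    (j : ℕ) (h1 : 1 ≤ j) (h2 : j ≤ n) (hm : m (1, j) ≠ 0) :
    ∃ l, 1 ≤ l ∧ l ≤ n ∧ comp T l = comp T j ∧ m' (1, l) ≠ 0 := by
  by_contra hcon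
  push Not at hcon
  have h3 := congrArg (fun x => x (Sum.inr (comp T j))) h
  simp only [ptExp_inr] at h3
  have h4 : ∑ j ∈ (Finset.Icc 1 n).filter (fun i => comp T i = comp T j), (m (1, j) + m (2, j)) =
      ∑ j ∈ (Finset.Icc 1 n).filter (fun i => comp T i = comp T j), (m' (1, j) + m' (2, j)) := by
    apply Finset.sum_congr rfl
    intro l hl
    simp only [Finset.mem_filter, Finset.mem_Icc] at hl
    rw [← ptExp_inl_one n T m l hl.1.1 hl.1.2, ← ptExp_inl_one n T m' l hl.1.1 hl.1.2, h]
  rw [Finset.sum_add_distrib, Finset.sum_add_distrib, h3, add_left_inj,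
    Finset.sum_eq_zero (f := fun j => m' (1, j))] at h4
  · rw [Finset.sum_eq_zero_iff] at h4
    exact hm (h4 j (by simp [h1, h2]))
  · intro l hl
    simp only [Finset.mem_filter, Finset.mem_Icc] at hl
    exact hcon l hl.1.1 hl.1.2 hl.2

variable (K : Type*) [Field K]

lemma X_mem_pathPT {v : ℕ × ℕ} (hv : v ∈ ptVars T) : X v ∈ pathPT K n T := by
  apply Ideal.subset_span
  exact Or.inl ⟨v.1, v.2, hv.1, hv.2, rfl⟩

lemma minor_mem_pathPT_lt {j l : ℕ} (hlt : j < l) (hj1 : 1 ≤ j) (hjT : j ∉ T)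
    (hl2 : l ≤ n) (hlT : l ∉ T) (hc : comp T j = comp T l) : minor K 1 2 j l ∈ pathPT K n T := by
  apply Ideal.subset_span
  refine Or.inr ⟨j, l, hlt, ⟨⟨hj1, by omega⟩, hjT⟩, ⟨⟨by omega, hl2⟩, hlT⟩, ?_, rfl⟩
  rintro w hw ⟨h1, h2⟩
  have h3 : w ∈ comp T l := ⟨hw, h2⟩
  rw [← hc] at h3
  exact absurd h3.2 (by omega)

lemma minor_mem_pathPT {j l : ℕ} (hj1 : 1 ≤ j) (hj2 : j ≤ n) (hjT : j ∉ T) (hl1 : 1 ≤ l)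
    (hl2 : l ≤ n) (hlT : l ∉ T) (hc : comp T j = comp T l) : minor K 1 2 j l ∈ pathPT K n T := by
  rcases lt_trichotomy j l with h | h | h
  · exact minor_mem_pathPT_lt K h hj1 hjT hl2 hlT hc
  · subst h
    simp [minor]
  · have h2 := minor_mem_pathPT_lt K h hl1 hlT hj2 hjT hc.symm
    have : minor K 1 2 j l = - minor K 1 2 l j := by simp only [minor]; ring
    rw [this]
    exact neg_mem h2

lemma exists_eq_add_single {σ : Type*} (m : σ →₀ ℕ) (v : σ) (h : m v ≠ 0) :
    ∃ m1, m = m1 + Finsupp.single v 1 := by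
  refine ⟨m - Finsupp.single v 1, (tsub_add_cancel_of_le ?_).symm⟩
  rw [Finsupp.single_le_iff]; omega

lemma ptExp_swap (m : ℕ × ℕ →₀ ℕ) {j l : ℕ} (hj1 : 1 ≤ j) (hj2 : j ≤ n) (hl1 : 1 ≤ l)
    (hl2 : l ≤ n) (hc : comp T j = comp T l) :
    toricExp (ptExp n T) (m + Finsupp.single (2, j) 1 + Finsupp.single (1, l) 1) =
    toricExp (ptExp n T) (m + Finsupp.single (2, l) 1 + Finsupp.single (1, j) 1) := by
  simp only [map_add, toricExp_single, one_smul]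
  simp only [ptExp, hj1, hj2, hl1, hl2, hc]
  simp
  abel

lemma monomial_add_single' {σ : Type*} (m : σ →₀ ℕ) (v : σ) :
    monomial (m + Finsupp.single v 1) (1 : K) = monomial m 1 * X v := by
  rw [X, monomial_mul, one_mul]

lemma pathPT_binomial (m m' : ℕ × ℕ →₀ ℕ) (hm : ∀ v ∈ ptVars T, m v = 0)
    (hm' : ∀ v ∈ ptVars T, m' v = 0)
    (h : toricExp (ptExp n T) m = toricExp (ptExp n T) m') :
    monomial m (1 : K) - monomial m' 1 ∈ pathPT K n T := by
  induction hd : m.degree generalizing m m' with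
  | zero =>
    rw [Finsupp.degree_eq_zero_iff] at hd
    subst hd
    have : m' = 0 := by
      by_contra hne
      obtain ⟨v, hv⟩ := Finsupp.ne_iff.mp hne
      obtain ⟨m1, rfl⟩ := exists_eq_add_single m' v hv
      rw [map_zero, map_add, toricExp_single, one_smul, eq_comm, add_eq_zero] at h
      have h2 := h.2
      unfold ptExp at h2
      split_ifs at h2 <;> simp at h2
    rw [this, sub_self]; exact zero_mem _
  | succ d ih =>
    have cancel : ∀ (v : ℕ × ℕ) (m' : ℕ × ℕ →₀ ℕ), (∀ v ∈ ptVars T, m' v = 0) →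
        toricExp (ptExp n T) m = toricExp (ptExp n T) m' → m v ≠ 0 → m' v ≠ 0 →
        monomial m (1 : K) - monomial m' 1 ∈ pathPT K n T := by
      intro v m' hm' h hv hv'
      obtain ⟨m1, rfl⟩ := exists_eq_add_single m v hv
      obtain ⟨m2, rfl⟩ := exists_eq_add_single m' v hv'
      rw [map_add, map_add, add_left_inj] at h
      rw [map_add, Finsupp.degree_single] at hd
      rw [monomial_add_single', monomial_add_single', ← sub_mul]
      apply Ideal.mul_mem_right
      apply ih m1 m2 _ _ h (by omega)
      · intro w hw
        have := hm w hw
        rw [Finsupp.add_apply] at this; omega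
      · intro w hw
        have := hm' w hw
        rw [Finsupp.add_apply] at this; omega
    have notT : ∀ (m : ℕ × ℕ →₀ ℕ), (∀ v ∈ ptVars T, m v = 0) → ∀ a j, (a = 1 ∨ a = 2) →
        m (a, j) ≠ 0 → j ∉ T := by
      intro m hm a j ha hne hj
      exact hne (hm _ ⟨ha, hj⟩)
    have swap : ∀ j l, 1 ≤ j → j ≤ n → 1 ≤ l → l ≤ n → comp T j = comp T l → m' (2, j) ≠ 0 →
        m' (1, l) ≠ 0 → (m (1, j) ≠ 0 ∨ m (2, l) ≠ 0) →
        monomial m (1 : K) - monomial m' 1 ∈ pathPT K n T := by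
      intro j l hj1 hj2 hl1 hl2 hc h2 h3 h4
      have hjT := notT m' hm' 2 j (Or.inr rfl) h2
      have hlT := notT m' hm' 1 l (Or.inl rfl) h3
      obtain ⟨m1, rfl⟩ := exists_eq_add_single m' (1, l) h3
      obtain ⟨m2, rfl⟩ := exists_eq_add_single m1 (2, j) (by simpa using h2)
      have h5 := ptExp_swap (n := n) (T := T) m2 hj1 hj2 hl1 hl2 hc
      have h6 : ∀ v ∈ ptVars T, (m2 + Finsupp.single (2, l) 1 + Finsupp.single (1, j) 1 :
          ℕ × ℕ →₀ ℕ) v = 0 := by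
        intro v hv
        have h7 := hm' v hv
        simp only [Finsupp.add_apply] at h7 ⊢
        have h8 : (2, l) ≠ v := by rintro rfl; exact hlT hv.2
        have h9 : (1, j) ≠ v := by rintro rfl; exact hjT hv.2
        rw [Finsupp.single_apply, Finsupp.single_apply, if_neg h8, if_neg h9]
        omega
      have h7 : monomial m (1 : K) - monomial (m2 + Finsupp.single (2, l) 1 +
          Finsupp.single (1, j) 1) 1 ∈ pathPT K n T := by
        rcases h4 with h4 | h4
        · exact cancel (1, j) _ h6 (h.trans h5) h4 (by simp)
        · exact cancel (2, l) _ h6 (h.trans h5) h4 (by simp)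
      have h8 := minor_mem_pathPT K hj1 hj2 hjT hl1 hl2 hlT hc
      have h9 := add_mem h7 (Ideal.mul_mem_left _ (monomial m2 (1 : K)) h8)
      convert h9 using 1
      simp only [monomial_add_single', minor]
      ring
    have hne : m ≠ 0 := by
      rintro rfl
      simp at hd
    obtain ⟨⟨a, j⟩, hv⟩ := Finsupp.ne_iff.mp hne
    simp only [Finsupp.coe_zero, Pi.zero_apply] at hv
    by_cases hv' : m' (a, j) = 0
    swap
    · exact cancel _ m' hm' h hv hv'
    by_cases hcase : (a = 1 ∨ a = 2) ∧ 1 ≤ j ∧ j ≤ n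
    swap
    · have h2 := congrArg (fun x => x (Sum.inl (a, j))) h
      rw [ptExp_inl_other n T m _ hcase, ptExp_inl_other n T m' _ hcase] at h2
      omega
    obtain ⟨ha, hj1, hj2⟩ := hcase
    have h2 := congrArg (fun x => x (Sum.inl (1, j))) h
    rw [ptExp_inl_one n T m _ hj1 hj2, ptExp_inl_one n T m' _ hj1 hj2] at h2
    rcases ha with rfl | rfl
    · obtain ⟨l, hl1, hl2, hc, hl⟩ := ptExp_row_one h j hj1 hj2 hv
      exact swap j l hj1 hj2 hl1 hl2 hc.symm (by omega) hl (Or.inl hv)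
    · obtain ⟨l, hl1, hl2, hc, hl⟩ := ptExp_row_two h j hj1 hj2 hv
      exact swap l j hl1 hl2 hj1 hj2 hc hl (by omega) (Or.inr hv)

lemma toricMap_minor {u v : ℕ} (hu1 : 1 ≤ u) (hu2 : u ≤ n) (hu : u ∉ T) (hv1 : 1 ≤ v) (hv2 : v ≤ n)
    (hv : v ∉ T) : toricMap K (ptVars T) (ptExp n T) (minor K 1 2 u v) =
      monomial (Finsupp.single (Sum.inl (1, u)) 1 + Finsupp.single (Sum.inl (1, v)) 1 +
        Finsupp.single (Sum.inr (comp T v)) 1) 1 -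
      monomial (Finsupp.single (Sum.inl (1, u)) 1 + Finsupp.single (Sum.inl (1, v)) 1 +
        Finsupp.single (Sum.inr (comp T u)) 1) 1 := by
  have h : ∀ a j, j ∉ T → (a, j) ∉ ptVars T := fun a j hj h => hj h.2
  rw [minor, map_sub, map_mul, map_mul, toricMap_X _ (h _ _ hu), toricMap_X _ (h _ _ hv),
    toricMap_X _ (h _ _ hu), toricMap_X _ (h _ _ hv), monomial_mul, monomial_mul]
  simp only [ptExp, hu1, hu2, hv1, hv2]
  simp
  congr 2 <;> abel_nf

lemma pathPT_eq_ker : pathPT K n T = RingHom.ker (toricMap K (ptVars T) (ptExp n T)) := by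
  apply le_antisymm
  · apply Ideal.span_le.mpr
    rintro f (⟨i, j, hi, hj, rfl⟩ | ⟨u, v, huv, ⟨hu, huT⟩, ⟨hv, hvT⟩, hw, rfl⟩)
    · exact toricMap_X_mem _ ⟨hi, hj⟩
    · have hc : comp T u = comp T v := by
        ext w
        refine ⟨fun h => ⟨h.1, h.2.trans huv⟩, fun h => ⟨h.1, ?_⟩⟩
        by_contra h2
        rcases (not_lt.mp h2).eq_or_lt with h3 | h3
        · subst h3; exact huT h.1
        · exact hw w h.1 ⟨h3, h.2⟩
      show toricMap K (ptVars T) (ptExp n T) _ = 0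
      rw [toricMap_minor K hu.1 hu.2 huT hv.1 hv.2 hvT, hc, sub_self]
  · intro p hp
    exact toricMap_ker_le _ _ _ (fun v hv => X_mem_pathPT K hv) (pathPT_binomial K) p hp

lemma pathPT_isPrime : (pathPT K n T).IsPrime := by
  rw [pathPT_eq_ker]
  exact RingHom.ker_isPrime _

lemma X_notMem_pathPT (a : ℕ) {j : ℕ} (hj : j ∉ T) : X (a, j) ∉ pathPT K n T := by
  rw [pathPT_eq_ker, RingHom.mem_ker, toricMap_X _ (fun h => hj h.2)]
  simp

lemma minor_notMem_pathPT {j : ℕ} (hj1 : 2 ≤ j) (hj2 : j + 1 ≤ n) (hj : j ∈ T) (h1 : j - 1 ∉ T)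
    (h2 : j + 1 ∉ T) : minor K 1 2 (j - 1) (j + 1) ∉ pathPT K n T := by
  rw [pathPT_eq_ker, RingHom.mem_ker, toricMap_minor K (by omega) (by omega) h1 (by omega) hj2 h2,
    sub_eq_zero]
  intro h
  rw [monomial_left_inj one_ne_zero, add_right_inj, Finsupp.single_left_inj one_ne_zero,
    Sum.inr.injEq] at h
  have h3 : j ∈ comp T (j + 1) := ⟨hj, by omega⟩
  rw [h] at h3
  exact absurd h3.2 (by omega)

end PT

section Final

lemma QuasiReg.cancel {R : Type*} [CommRing R] {f : ℕ → R} {r : ℕ} (h : QuasiReg f r) {i : ℕ}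
    (hi : i < r) (k : ℕ) (y : R) (hy : f i * y ∈ seqIdeal f r ^ (k + 1)) :
    y ∈ seqIdeal f r ^ k := by
  have key : ∀ s, s ≤ k → y ∈ seqIdeal f r ^ s := by
    intro s
    induction s with
    | zero => intro _; simp
    | succ s ih =>
      intro hs
      obtain ⟨F, hF, rfl⟩ := exists_form f r s y (ih (by omega))
      apply hF.eval_mem_succ
      intro m
      have h1 := h (s + 1) (F * X i) (hF.mul_X hi) (by
        rw [map_mul, eval_X, mul_comm]
        exact Ideal.pow_le_pow_right (by omega) hy) (m + Finsupp.single i 1)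
      rwa [coeff_mul_X] at h1
  exact key k le_rfl

lemma QuasiReg.cancel_pow {R : Type*} [CommRing R] {f : ℕ → R} {r : ℕ} (h : QuasiReg f r) {i : ℕ}
    (hi : i < r) (k : ℕ) (y : R) (hy : f i ^ k * y ∈ seqIdeal f r ^ (k + 1)) :
    y ∈ seqIdeal f r := by
  induction k with
  | zero => simpa using hy
  | succ k ih =>
    apply ih
    apply h.cancel hi
    rwa [← mul_assoc, ← pow_succ']

variable {K : Type*} [Field K]

lemma homogeneousComponent_mul_right {σ : Type*} (p q : MvPolynomial σ K) (e d : ℕ)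
    (hq : q.IsHomogeneous e) :
    homogeneousComponent d (p * q) = if e ≤ d then homogeneousComponent (d - e) p * q else 0 := by
  letI := gradedAlgebra (σ := σ) (R := K)
  have := DirectSum.coe_decompose_mul_of_right_mem (𝒜 := homogeneousSubmodule σ K) (a := p) d
    (i := e) (b := q) hq
  rw [← decomposition.decompose'_apply, ← decomposition.decompose'_apply]
  exact this

lemma colon_mem_iff {R : Type*} [CommRing R] (I : Ideal R) (f x : R) :
    x ∈ Submodule.colon I (Ideal.span {f} : Ideal R) ↔ x * f ∈ I :=
  Ideal.mem_colon_span_singleton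

lemma colon_pow_down {f : ℕ → MvPolynomial (ℕ × ℕ) K} {r : ℕ} (hr : 0 < r) (hq : QuasiReg f r)
    (hf : ∀ i, (f i).IsHomogeneous 2) (P : Ideal (MvPolynomial (ℕ × ℕ) K)) [hP : P.IsPrime]
    (hJP : seqIdeal f r ≤ P) (k d : ℕ) (g : MvPolynomial (ℕ × ℕ) K) (hg : g.IsHomogeneous d)
    (hc : Submodule.colon (seqIdeal f r ^ (k + 1)) (Ideal.span {g} : Ideal _) = P) :
    ∃ (e : ℕ) (a : MvPolynomial (ℕ × ℕ) K), e + 2 * k = d ∧ a.IsHomogeneous e ∧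
      Submodule.colon (seqIdeal f r) (Ideal.span {a} : Ideal _) = P := by
  have hgJ : g ∈ seqIdeal f r ^ k := by
    apply hq.cancel hr
    rw [← colon_mem_iff, hc]
    exact hJP (mem_seqIdeal f hr)
  have hg0 : g ≠ 0 := by
    rintro rfl
    apply hP.ne_top
    rw [Ideal.eq_top_iff_one, ← hc, colon_mem_iff]
    simp
  obtain ⟨F, hF, hFg⟩ := exists_form f r k g hgJ
  have hhom : ∀ m : ℕ →₀ ℕ, (∏ i ∈ m.support, f i ^ m i).IsHomogeneous (2 * m.degree) := by
    intro m
    rw [Finsupp.degree_apply, Finset.mul_sum]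
    apply IsHomogeneous.prod
    intro i _
    exact (hf i).pow (m i)
  have hgd : g = ∑ m ∈ F.support, if 2 * k ≤ d then
      homogeneousComponent (d - 2 * k) (coeff m F) * ∏ i ∈ m.support, f i ^ m i else 0 := by
    have h1 : homogeneousComponent d g = g := by
      rw [homogeneousComponent_of_mem hg, if_pos rfl]
    conv_lhs => rw [← h1, ← hFg, eval_eq, map_sum]
    apply Finset.sum_congr rfl
    intro m hm
    rw [homogeneousComponent_mul_right _ _ _ _ (hhom m), (hF m (mem_support_iff.mp hm)).1]
  by_cases hkd : 2 * k ≤ d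
  swap
  · simp only [if_neg hkd, Finset.sum_const_zero] at hgd
    exact absurd hgd hg0
  simp only [if_pos hkd] at hgd
  set A : (ℕ →₀ ℕ) → MvPolynomial (ℕ × ℕ) K :=
    fun m => homogeneousComponent (d - 2 * k) (coeff m F) with hA
  have hcol : P = F.support.inf (fun m => Submodule.colon (seqIdeal f r)
      (Ideal.span {A m} : Ideal _)) := by
    ext x
    rw [← hc, colon_mem_iff, Submodule.mem_finsetInf]
    simp only [colon_mem_iff]
    set F' : MvPolynomial ℕ (MvPolynomial (ℕ × ℕ) K) :=
      ∑ m ∈ F.support, monomial m (x * A m) with hF'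
    have hcoeff : ∀ m, coeff m F' = if m ∈ F.support then x * A m else 0 := by
      intro m
      rw [hF', coeff_sum]
      simp only [coeff_monomial]
      rw [Finset.sum_ite_eq']
    have hform : IsForm r k F' := by
      intro m hm
      rw [hcoeff] at hm
      split_ifs at hm with h
      · exact hF m (mem_support_iff.mp h)
      · exact absurd rfl hm
    have hev : eval f F' = x * g := by
      rw [hF', map_sum, hgd, Finset.mul_sum]
      apply Finset.sum_congr rfl
      intro m _
      rw [eval_monomial, Finsupp.prod, mul_assoc]
    constructor
    · intro hx m hm
      have := hq k F' hform (by rwa [hev]) m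
      rwa [hcoeff, if_pos hm] at this
    · intro hx
      rw [← hev]
      apply hform.eval_mem_succ
      intro m
      rw [hcoeff]
      split_ifs with h
      · exact hx m h
      · exact zero_mem _
  obtain ⟨m, hm, hle⟩ := (hP.inf_le').mp hcol.ge
  refine ⟨d - 2 * k, A m, by omega, homogeneousComponent_isHomogeneous _ _, le_antisymm hle ?_⟩
  conv_lhs => rw [hcol]
  exact Finset.inf_le hm

lemma colon_pow_up {f : ℕ → MvPolynomial (ℕ × ℕ) K} {r : ℕ} (hr : 0 < r) (hq : QuasiReg f r)
    (hf : ∀ i, (f i).IsHomogeneous 2) (P : Ideal (MvPolynomial (ℕ × ℕ) K))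
    (k d : ℕ) (g : MvPolynomial (ℕ × ℕ) K) (hg : g.IsHomogeneous d)
    (hc : Submodule.colon (seqIdeal f r) (Ideal.span {g} : Ideal _) = P) :
    ∃ a : MvPolynomial (ℕ × ℕ) K, a.IsHomogeneous (d + 2 * k) ∧
      Submodule.colon (seqIdeal f r ^ (k + 1)) (Ideal.span {a} : Ideal _) = P := by
  refine ⟨g * f 0 ^ k, hg.mul ((hf 0).pow k), ?_⟩
  rw [← hc]
  ext x
  rw [colon_mem_iff, colon_mem_iff]
  constructor
  · intro h
    apply hq.cancel_pow hr k
    convert h using 1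
    ring
  · intro h
    rw [← mul_assoc, pow_succ']
    exact Ideal.mul_mem_mul h (Ideal.pow_mem_pow (mem_seqIdeal f hr) k)

lemma minor_isHomogeneous (a b k l : ℕ) : (minor K a b k l).IsHomogeneous 2 := by
  apply IsHomogeneous.sub
  · exact (isHomogeneous_X K _).mul (isHomogeneous_X K _)
  · exact (isHomogeneous_X K _).mul (isHomogeneous_X K _)

lemma pathBEI_eq (n : ℕ) : pathBEI K n = seqIdeal (pathSeq K) (n - 1) := by
  unfold pathBEI seqIdeal
  congr 1
  ext p
  constructor
  · rintro ⟨i, h1, h2, rfl⟩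
    refine ⟨i - 1, by simp only [Set.mem_Iio]; omega, ?_⟩
    obtain ⟨i, rfl⟩ : ∃ j, i = j + 1 := ⟨i - 1, by omega⟩
    rfl
  · rintro ⟨i, hi, rfl⟩
    simp only [Set.mem_Iio] at hi
    exact ⟨i + 1, by omega, by omega, rfl⟩

lemma minor_mem_pathBEI {n i : ℕ} (h1 : 1 ≤ i) (h2 : i + 1 ≤ n) :
    minor K 1 2 i (i + 1) ∈ pathBEI K n := Ideal.subset_span ⟨i, h1, h2, rfl⟩

lemma pathBEI_le_pathPT (n : ℕ) (T : Set ℕ) : pathBEI K n ≤ pathPT K n T := by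
  apply Ideal.span_le.mpr
  rintro _ ⟨i, h1, h2, rfl⟩
  by_cases hi : i ∈ T
  · apply sub_mem
    · exact Ideal.mul_mem_right _ _ (X_mem_pathPT K ⟨Or.inl rfl, hi⟩)
    · exact Ideal.mul_mem_left _ _ (X_mem_pathPT K ⟨Or.inr rfl, hi⟩)
  by_cases hi' : i + 1 ∈ T
  · apply sub_mem
    · exact Ideal.mul_mem_left _ _ (X_mem_pathPT K ⟨Or.inr rfl, hi'⟩)
    · exact Ideal.mul_mem_right _ _ (X_mem_pathPT K ⟨Or.inl rfl, hi'⟩)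
  apply minor_mem_pathPT_lt K (Nat.lt_succ_self i) h1 hi h2 hi'
  ext w
  constructor
  · exact fun h => ⟨h.1, h.2.trans (Nat.lt_succ_self i)⟩
  · intro h
    refine ⟨h.1, lt_of_le_of_ne (Nat.lt_succ_iff.mp h.2) ?_⟩
    rintro rfl
    exact hi h.1

lemma prod_mul_minor_mem (n u : ℕ) (hu : 1 ≤ u) (v : ℕ) (huv : u + 1 ≤ v) (hv : v ≤ n) :
    (∏ j ∈ Finset.Ico (u + 1) v, X (1, j)) * minor K 1 2 u v ∈ pathBEI K n := by
  induction v, huv using Nat.le_induction with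
  | base => simpa using minor_mem_pathBEI (K := K) hu hv
  | succ v huv ih =>
    have ih := ih (by omega)
    rw [Finset.prod_Ico_succ_top huv]
    have h1 := minor_mem_pathBEI (K := K) (n := n) (i := v) (by omega) hv
    have h2 := add_mem (Ideal.mul_mem_left _ (X (1, v + 1)) ih)
      (Ideal.mul_mem_left _ ((∏ j ∈ Finset.Ico (u + 1) v, X (1, j)) * X (1, u)) h1)
    convert h2 using 1
    simp only [minor]
    ring

lemma X_mul_minor_mem (n a j : ℕ) (ha : a = 1 ∨ a = 2) (h1 : 2 ≤ j) (h2 : j + 1 ≤ n) :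
    X (a, j) * minor K 1 2 (j - 1) (j + 1) ∈ pathBEI K n := by
  obtain ⟨i, rfl⟩ : ∃ i, j = i + 1 := ⟨j - 1, by omega⟩
  have h3 := minor_mem_pathBEI (K := K) (n := n) (i := i) (by omega) (by omega)
  have h4 := minor_mem_pathBEI (K := K) (n := n) (i := i + 1) (by omega) h2
  have h5 := add_mem (Ideal.mul_mem_left _ (X (a, i + 1 + 1)) h3)
      (Ideal.mul_mem_left _ (X (a, i)) h4)
  convert h5 using 1
  rw [Nat.add_sub_cancel]
  rcases ha with rfl | rfl <;> simp only [minor] <;> ring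

open Classical in
lemma exists_witness (n : ℕ) (T : Set ℕ) (hTsub : T ⊆ Set.Icc 2 (n - 1))
    (hTgap : ∀ j ∈ T, j + 1 ∉ T) :
    ∃ d, ∃ f : MvPolynomial (ℕ × ℕ) K, f.IsHomogeneous d ∧
      Submodule.colon (pathBEI K n) (Ideal.span {f} : Ideal _) = pathPT K n T := by
  set A : MvPolynomial (ℕ × ℕ) K :=
    ∏ j ∈ (Finset.Icc 1 n).filter (· ∈ T), minor K 1 2 (j - 1) (j + 1) with hA
  set B : MvPolynomial (ℕ × ℕ) K := ∏ j ∈ (Finset.Icc 1 n).filter (· ∉ T), X (1, j) with hB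
  have hprime := pathPT_isPrime (n := n) (T := T) K
  have hT : ∀ j ∈ T, 2 ≤ j ∧ j + 1 ≤ n := by
    intro j hj
    have := hTsub hj
    simp only [Set.mem_Icc] at this
    omega
  have hAP : A ∉ pathPT K n T := by
    rw [hA, Ideal.IsPrime.prod_mem_iff]
    rintro ⟨j, hj, h⟩
    have hjT := (Finset.mem_filter.mp hj).2
    obtain ⟨h1, h2⟩ := hT j hjT
    refine minor_notMem_pathPT K h1 h2 hjT ?_ (hTgap j hjT) h
    intro h3
    apply hTgap _ h3
    rwa [Nat.sub_add_cancel (by omega)]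
  have hBP : B ∉ pathPT K n T := by
    rw [hB, Ideal.IsPrime.prod_mem_iff]
    rintro ⟨j, hj, h⟩
    exact X_notMem_pathPT K 1 (Finset.mem_filter.mp hj).2 h
  refine ⟨_, A * B, IsHomogeneous.mul
    (IsHomogeneous.prod _ _ (fun _ => 2) fun j _ => minor_isHomogeneous _ _ _ _)
    (IsHomogeneous.prod _ _ (fun _ => 1) fun j _ => isHomogeneous_X K _), ?_⟩
  apply le_antisymm
  · intro x hx
    rw [colon_mem_iff] at hx
    rcases hprime.mem_or_mem (pathBEI_le_pathPT n T hx) with h | h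
    · exact h
    · rcases hprime.mem_or_mem h with h | h
      · exact absurd h hAP
      · exact absurd h hBP
  · apply Ideal.span_le.mpr
    rintro f (⟨i, j, hi, hj, rfl⟩ | ⟨u, v, huv, ⟨hu, huT⟩, ⟨hv, hvT⟩, hw, rfl⟩)
    · rw [SetLike.mem_coe, colon_mem_iff, ← mul_assoc]
      apply Ideal.mul_mem_right
      obtain ⟨h1, h2⟩ := hT j hj
      obtain ⟨q, hq⟩ : minor K 1 2 (j - 1) (j + 1) ∣ A :=
        Finset.dvd_prod_of_mem (fun j => minor K 1 2 (j - 1) (j + 1))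
          (by simp [hj]; omega)
      rw [hq, ← mul_assoc]
      exact Ideal.mul_mem_right _ _ (X_mul_minor_mem n i j hi h1 h2)
    · rw [SetLike.mem_coe, colon_mem_iff, mul_left_comm]
      apply Ideal.mul_mem_left
      obtain ⟨q, hq⟩ : (∏ j ∈ Finset.Ico (u + 1) v, X (1, j) : MvPolynomial (ℕ × ℕ) K) ∣ B := by
        apply Finset.prod_dvd_prod_of_subset
        intro j hj
        simp only [Finset.mem_Ico, Finset.mem_filter, Finset.mem_Icc, Set.mem_Icc] at hj hu hv ⊢
        refine ⟨by omega, fun hjT => hw j hjT (by omega)⟩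
      rw [hq, mul_comm, mul_right_comm]
      exact Ideal.mul_mem_right _ _ (prod_mul_minor_mem n u hu.1 v huv hv.2)

end Final


/-- Proposition 6.5: for the path `P_n` (`n ≥ 3`) and any cut set `T` of `P_n`,
`v_T(J_{K_2,P_n}^k) = v_T(J_{K_2,P_n}) + 2(k−1)` for all `k ≥ 1`. -/
theorem localVNumber_pow_path
    (K : Type*) [Field K] (n : ℕ) (hn : 3 ≤ n)
    (T : Set ℕ) (hTsub : T ⊆ Set.Icc 2 (n - 1))
    (hTgap : ∀ j ∈ T, j + 1 ∉ T)
    (k : ℕ) (hk : 1 ≤ k) :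
    localVNumberPath K n T ((pathBEI K n) ^ k) =
      localVNumberPath K n T (pathBEI K n) + 2 * (k - 1) := by
  obtain ⟨k, rfl⟩ : ∃ j, k = j + 1 := ⟨k - 1, by omega⟩
  rw [Nat.add_sub_cancel]
  have hr : 0 < n - 1 := by omega
  have hq := pathSeq_quasiReg K (n - 1)
  have hf : ∀ i, (pathSeq K i).IsHomogeneous 2 := fun i => minor_isHomogeneous _ _ _ _
  have hprime := pathPT_isPrime (n := n) (T := T) K
  have hle := pathBEI_le_pathPT (K := K) n T
  have hne := exists_witness (K := K) n T hTsub hTgap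
  unfold localVNumberPath
  rw [pathBEI_eq] at hle hne ⊢
  set S1 := {d : ℕ | ∃ f : MvPolynomial (ℕ × ℕ) K, f.IsHomogeneous d ∧
    Submodule.colon (seqIdeal (pathSeq K) (n - 1)) (Ideal.span {f} : Ideal _) = pathPT K n T}
    with hS1
  have hup : ∀ d ∈ S1, d + 2 * k ∈ {d : ℕ | ∃ f : MvPolynomial (ℕ × ℕ) K, f.IsHomogeneous d ∧
      Submodule.colon (seqIdeal (pathSeq K) (n - 1) ^ (k + 1)) (Ideal.span {f} : Ideal _) =
        pathPT K n T} := by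
    rintro d ⟨g, hg, hc⟩
    exact colon_pow_up hr hq hf _ k d g hg hc
  have hne1 : S1.Nonempty := hne
  apply le_antisymm
  · exact Nat.sInf_le (hup _ (Nat.sInf_mem hne1))
  · obtain ⟨g, hg, hc⟩ := Nat.sInf_mem (Set.nonempty_of_mem (hup _ (Nat.sInf_mem hne1)))
    obtain ⟨e, a, he, ha, hca⟩ := colon_pow_down hr hq hf _ hle k _ g hg hc
    have haS : e ∈ S1 := ⟨a, ha, hca⟩
    rw [← he]
    exact Nat.add_le_add_right (Nat.sInf_le haS) _
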